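/- arXiv:2012.15805 — 2 statements merged into one kernel-verified Lean document; each statement's English description precedes it below -/
import Mathlib

section
/- For every real x > 0, the modified Herglotz function satisfies 𝓕(x) − 𝓕(x+1) − 𝓕(x/(x+1)) = L(1/2) − L(x/(x+1)), and 𝓕(x) + 𝓕(1/x) = 0. -/
open Real

/-- The digamma function ψ = Γ′/Γ. -/
noncomputable def digamma (x : ℝ) : ℝ := deriv Real.Gamma x / Real.Gamma x

/-- The Herglotz function F(x) = ∑_{n≥1} (ψ(nx) − log(nx))/n. -/
noncomputable def herglotzF (x : ℝ) : ℝ :=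
  ∑' n : ℕ, (digamma (((n : ℝ) + 1) * x) - Real.log (((n : ℝ) + 1) * x)) / ((n : ℝ) + 1)

/-- The modified Herglotz function 𝓕(x) = F(x) − F(1) + (π²/12)(x − 2 + 1/x) − (log x)²/4. -/
noncomputable def mathcalF (x : ℝ) : ℝ :=
  herglotzF x - herglotzF 1 + Real.pi ^ 2 / 12 * (x - 2 + 1 / x) - Real.log x ^ 2 / 4

/-- The dilogarithm Li₂(x) = ∑_{n≥1} xⁿ/n². -/
noncomputable def Li2 (x : ℝ) : ℝ := ∑' n : ℕ, x ^ (n + 1) / ((n : ℝ) + 1) ^ 2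

open Classical in
/-- The Rogers dilogarithm, extended to all of ℝ. -/
noncomputable def rogersL (x : ℝ) : ℝ :=
  if x < 0 then -(Li2 (x / (x - 1)) + Real.log (x / (x - 1)) * Real.log (1 - x / (x - 1)) / 2)
  else if x ≤ 1 then Li2 x + Real.log x * Real.log (1 - x) / 2
  else Real.pi ^ 2 / 3 - (Li2 (1 / x) + Real.log (1 / x) * Real.log (1 - 1 / x) / 2)

open MeasureTheory Set Filter Topology

/-! ### The digamma function -/

theorem hasDerivAt_log_Gamma {x : ℝ} (hx : 0 < x) :
    HasDerivAt (Real.log ∘ Real.Gamma) (digamma x) x := by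
  have h : DifferentiableAt ℝ Real.Gamma x :=
    Real.differentiableAt_Gamma fun m => by
      have : (0 : ℝ) ≤ m := m.cast_nonneg
      linarith
  exact h.hasDerivAt.log (Real.Gamma_pos_of_pos hx).ne'

theorem log_Gamma_add_one {x : ℝ} (hx : 0 < x) :
    Real.log (Real.Gamma (x + 1)) = Real.log x + Real.log (Real.Gamma x) := by
  rw [Real.Gamma_add_one hx.ne', Real.log_mul hx.ne' (Real.Gamma_pos_of_pos hx).ne']

theorem digamma_add_one {x : ℝ} (hx : 0 < x) : digamma (x + 1) = digamma x + 1 / x := by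
  have h1 : HasDerivAt (fun y => (Real.log ∘ Real.Gamma) (y + 1)) (digamma (x + 1)) x :=
    (hasDerivAt_log_Gamma (by linarith : 0 < x + 1)).comp_add_const x 1
  have h2 : HasDerivAt (fun y => Real.log y + (Real.log ∘ Real.Gamma) y)
      (x⁻¹ + digamma x) x := (Real.hasDerivAt_log hx.ne').add (hasDerivAt_log_Gamma hx)
  have h3 := h2.congr_of_eventuallyEq (f₁ := fun y => (Real.log ∘ Real.Gamma) (y + 1)) (by
    filter_upwards [lt_mem_nhds hx] with y hy using log_Gamma_add_one hy)
  rw [h1.unique h3, one_div, add_comm]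

theorem digamma_le_log {x : ℝ} (hx : 0 < x) : digamma x ≤ Real.log x := by
  have h := Real.convexOn_log_Gamma.le_slope_of_hasDerivAt (mem_Ioi.2 hx)
    (mem_Ioi.2 (by linarith : 0 < x + 1)) (by linarith) (hasDerivAt_log_Gamma hx)
  simpa [slope_def_field, log_Gamma_add_one hx] using h

theorem log_sub_one_div_le_digamma {x : ℝ} (hx : 0 < x) : Real.log x - 1 / x ≤ digamma x := by
  have h := Real.convexOn_log_Gamma.slope_le_of_hasDerivAt (mem_Ioi.2 hx)
    (mem_Ioi.2 (by linarith : 0 < x + 1)) (by linarith)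
    (hasDerivAt_log_Gamma (by linarith : 0 < x + 1))
  rw [digamma_add_one hx] at h
  simp [slope_def_field, log_Gamma_add_one hx] at h
  rw [one_div]
  linarith

/-- The kernel `1 / (1 - e⁻ᵗ) - 1 / t` of the integral representation of `ψ(x) - log x`. -/
noncomputable def digammaKernel (t : ℝ) : ℝ := 1 / (1 - Real.exp (-t)) - 1 / t

theorem one_sub_exp_neg_pos {t : ℝ} (ht : 0 < t) : 0 < 1 - Real.exp (-t) := by
  have : Real.exp (-t) < 1 := by simpa using ht
  linarith

theorem digammaKernel_nonneg {t : ℝ} (ht : 0 < t) : 0 ≤ digammaKernel t := by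
  have h1 := one_sub_exp_neg_pos ht
  have h2 : 1 - Real.exp (-t) ≤ t := by linarith [Real.add_one_le_exp (-t)]
  exact sub_nonneg.2 (one_div_le_one_div_of_le h1 h2)

theorem digammaKernel_le_one {t : ℝ} (ht : 0 < t) : digammaKernel t ≤ 1 := by
  have h1 := one_sub_exp_neg_pos ht
  have h2 : (t + 1) * Real.exp (-t) ≤ 1 := by
    have := mul_le_mul_of_nonneg_right (Real.add_one_le_exp t) (Real.exp_pos (-t)).le
    rwa [← Real.exp_add, add_neg_cancel, Real.exp_zero] at this
  rw [digammaKernel, sub_le_iff_le_add, div_le_iff₀ h1]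
  field_simp
  nlinarith

theorem measurable_digammaKernel : Measurable digammaKernel := by
  unfold digammaKernel
  fun_prop

theorem norm_digammaKernel_le_one {t : ℝ} (ht : 0 < t) : ‖digammaKernel t‖ ≤ 1 := by
  rw [Real.norm_of_nonneg (digammaKernel_nonneg ht)]
  exact digammaKernel_le_one ht

theorem integrableOn_exp_neg_mul {x : ℝ} (hx : 0 < x) :
    IntegrableOn (fun t : ℝ => Real.exp (-(x * t))) (Ioi 0) := by
  simpa only [neg_mul] using integrableOn_exp_mul_Ioi (neg_lt_zero.2 hx) 0

theorem integral_exp_neg_mul {x : ℝ} (hx : 0 < x) :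
    ∫ t in Ioi (0 : ℝ), Real.exp (-(x * t)) = 1 / x := by
  simpa only [neg_mul, mul_zero, Real.exp_zero, neg_div_neg_eq, neg_zero] using
    integral_exp_mul_Ioi (neg_lt_zero.2 hx) 0

/-- Multiplication by the digamma kernel preserves integrability on `(0, ∞)`. -/
theorem MeasureTheory.IntegrableOn.digammaKernel_comp_mul {f : ℝ → ℝ} (hf : IntegrableOn f (Ioi 0))
    {c : ℝ} (hc : 0 < c) : IntegrableOn (fun t => digammaKernel (c * t) * f t) (Ioi 0) := by
  refine Integrable.bdd_mul (c := 1) hf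
    (measurable_digammaKernel.comp (measurable_const_mul c)).aestronglyMeasurable ?_
  filter_upwards [ae_restrict_mem measurableSet_Ioi] with t ht
  exact norm_digammaKernel_le_one (mul_pos hc ht)

theorem MeasureTheory.IntegrableOn.digammaKernel_mul {f : ℝ → ℝ} (hf : IntegrableOn f (Ioi 0)) :
    IntegrableOn (fun t => digammaKernel t * f t) (Ioi 0) := by
  simpa using hf.digammaKernel_comp_mul one_pos

theorem integral_digammaKernel_mul_exp_nonneg (x : ℝ) :
    0 ≤ ∫ t in Ioi (0 : ℝ), digammaKernel t * Real.exp (-(x * t)) :=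
  setIntegral_nonneg measurableSet_Ioi fun _ ht =>
    mul_nonneg (digammaKernel_nonneg ht) (Real.exp_pos _).le

theorem integral_digammaKernel_mul_exp_le {x : ℝ} (hx : 0 < x) :
    ∫ t in Ioi (0 : ℝ), digammaKernel t * Real.exp (-(x * t)) ≤ 1 / x := by
  rw [← integral_exp_neg_mul hx]
  refine setIntegral_mono_on (integrableOn_exp_neg_mul hx).digammaKernel_mul
    (integrableOn_exp_neg_mul hx) measurableSet_Ioi fun t ht => ?_
  exact mul_le_of_le_one_left (Real.exp_pos _).le (digammaKernel_le_one ht)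

theorem integral_digammaKernel_mul_exp_add_one {x : ℝ} (hx : 0 < x) :
    ∫ t in Ioi (0 : ℝ), digammaKernel t * Real.exp (-((x + 1) * t)) =
      (∫ t in Ioi (0 : ℝ), digammaKernel t * Real.exp (-(x * t))) +
        Real.log ((x + 1) / x) - 1 / x := by
  have hx1 : 0 < x + 1 := by linarith
  have i0 := integrableOn_exp_neg_mul hx
  have i1 := i0.digammaKernel_mul
  have i2 := (integrableOn_exp_neg_mul hx1).digammaKernel_mul
  have key : ∀ t ∈ Ioi (0 : ℝ),
      t⁻¹ • (Real.exp (-(x * t)) - Real.exp (-((x + 1) * t))) =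
        digammaKernel t * Real.exp (-((x + 1) * t)) -
          digammaKernel t * Real.exp (-(x * t)) + Real.exp (-(x * t)) := by
    intro t ht
    have h1 := one_sub_exp_neg_pos (mem_Ioi.1 ht)
    have h2 : t ≠ 0 := (mem_Ioi.1 ht).ne'
    have h3 : Real.exp (-((x + 1) * t)) = Real.exp (-(x * t)) * Real.exp (-t) := by
      rw [← Real.exp_add]; ring_nf
    rw [h3, digammaKernel, smul_eq_mul]
    field_simp
    ring
  have hcont : Continuous fun t : ℝ => Real.exp (-t) := by fun_prop
  have i3 : IntegrableOn (fun t => digammaKernel t * Real.exp (-((x + 1) * t)) -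
      digammaKernel t * Real.exp (-(x * t))) (Ioi 0) := i2.sub i1
  have hfr := Frullani.integral_Ioi_eq (f := fun t : ℝ => Real.exp (-t)) (a := x) (b := x + 1)
    (L := 1) (R := 0)
    (hcont.locallyIntegrable.locallyIntegrableOn _) hx hx1
    (by simpa using (hcont.tendsto 0).mono_left nhdsWithin_le_nhds)
    (Real.tendsto_exp_neg_atTop_nhds_zero)
    ((i3.add i0).congr_fun (fun t ht => (key t ht).symm) measurableSet_Ioi)
  rw [setIntegral_congr_fun measurableSet_Ioi key, integral_add i3 i0,
    integral_sub i2 i1, integral_exp_neg_mul hx, sub_zero, smul_eq_mul, mul_one] at hfr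
  linarith

/-- Binet's integral representation of the digamma function. -/
theorem digamma_sub_log_eq_integral {x : ℝ} (hx : 0 < x) :
    digamma x - Real.log x =
      -∫ t in Ioi (0 : ℝ), digammaKernel t * Real.exp (-(x * t)) := by
  set D : ℝ → ℝ := fun x => digamma x - Real.log x +
    ∫ t in Ioi (0 : ℝ), digammaKernel t * Real.exp (-(x * t)) with hD
  have hper : ∀ y, 0 < y → D (y + 1) = D y := by
    intro y hy
    simp only [hD]
    rw [digamma_add_one hy, integral_digammaKernel_mul_exp_add_one hy,
      Real.log_div (by linarith) hy.ne']
    ring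
  have hper' : ∀ n : ℕ, D (x + n) = D x := by
    intro n
    induction n with
    | zero => simp
    | succ n ih => rw [Nat.cast_succ, ← add_assoc, hper _ (by positivity), ih]
  have hbound : ∀ y, 0 < y → |D y| ≤ 1 / y := by
    intro y hy
    have := digamma_le_log hy
    have := log_sub_one_div_le_digamma hy
    have := integral_digammaKernel_mul_exp_nonneg y
    have := integral_digammaKernel_mul_exp_le hy
    simp only [hD]
    rw [abs_le]
    constructor <;> linarith
  have hlim : Tendsto (fun n : ℕ => 1 / (x + n)) atTop (𝓝 0) :=
    (tendsto_const_nhds).div_atTop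
      (tendsto_atTop_add_const_left _ _ tendsto_natCast_atTop_atTop)
  have h0 : |D x| ≤ 0 := ge_of_tendsto' hlim fun n => by
    rw [← hper' n]
    exact hbound _ (by positivity)
  have : D x = 0 := abs_nonpos_iff.1 h0
  simp only [hD] at this
  linarith

/-! ### The Herglotz function as an integral -/

/-- The function `t ↦ log (1 - e⁻ᵗ)`. -/
noncomputable def logOneSubExp (t : ℝ) : ℝ := Real.log (1 - Real.exp (-t))

theorem exp_logOneSubExp {t : ℝ} (ht : 0 < t) :
    Real.exp (logOneSubExp t) = 1 - Real.exp (-t) :=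
  Real.exp_log (one_sub_exp_neg_pos ht)

theorem hasDerivAt_logOneSubExp {t : ℝ} (ht : 0 < t) :
    HasDerivAt logOneSubExp (digammaKernel t + 1 / t - 1) t := by
  have h1 := one_sub_exp_neg_pos ht
  have h : HasDerivAt logOneSubExp (-(Real.exp (-t) * -1) / (1 - Real.exp (-t))) t :=
    (((hasDerivAt_id t).neg.exp).const_sub 1).log h1.ne'
  refine h.congr_deriv ?_
  rw [digammaKernel]
  field_simp
  ring

theorem hasDerivAt_logOneSubExp_mul {c t : ℝ} (hc : 0 < c) (ht : 0 < t) :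
    HasDerivAt (fun t => logOneSubExp (c * t)) (c * digammaKernel (c * t) + 1 / t - c) t := by
  have h := (hasDerivAt_logOneSubExp (mul_pos hc ht)).comp t ((hasDerivAt_id t).const_mul c)
  refine h.congr_deriv ?_
  field_simp

theorem tendsto_logOneSubExp_atTop : Tendsto logOneSubExp atTop (𝓝 0) := by
  have h : Tendsto (fun t : ℝ => 1 - Real.exp (-t)) atTop (𝓝 1) := by
    simpa using Real.tendsto_exp_neg_atTop_nhds_zero.const_sub 1
  simpa [logOneSubExp] using! h.log one_ne_zero

theorem tendsto_logOneSubExp_sub_log :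
    Tendsto (fun t => logOneSubExp t - Real.log t) (𝓝[>] 0) (𝓝 0) := by
  have hd : HasDerivAt (fun t : ℝ => 1 - Real.exp (-t)) 1 0 := by
    refine (((hasDerivAt_id (0 : ℝ)).neg.exp).const_sub 1).congr_deriv ?_
    simp
  have h1 : Tendsto (fun t : ℝ => t⁻¹ * (1 - Real.exp (-t))) (𝓝[>] 0) (𝓝 1) := by
    simpa using hd.tendsto_slope_zero_right
  have h2 := h1.log one_ne_zero
  rw [Real.log_one] at h2
  refine h2.congr' ?_
  filter_upwards [self_mem_nhdsWithin] with t ht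
  rw [Real.log_mul (inv_ne_zero (mem_Ioi.1 ht).ne') (one_sub_exp_neg_pos ht).ne', Real.log_inv,
    logOneSubExp]
  ring

theorem tendsto_mul_nhdsGT_zero {c : ℝ} (hc : 0 < c) :
    Tendsto (fun t : ℝ => c * t) (𝓝[>] 0) (𝓝[>] 0) := by
  refine tendsto_nhdsWithin_iff.2 ⟨?_, ?_⟩
  · have : Continuous fun t : ℝ => c * t := by fun_prop
    simpa using (this.tendsto 0).mono_left nhdsWithin_le_nhds
  · filter_upwards [self_mem_nhdsWithin] with t ht using mul_pos hc ht

theorem tendsto_logOneSubExp_sub_comp_mul {c : ℝ} (hc : 0 < c) :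
    Tendsto (fun t => logOneSubExp t - logOneSubExp (c * t)) (𝓝[>] 0) (𝓝 (-Real.log c)) := by
  have h := (tendsto_logOneSubExp_sub_log.sub
    (tendsto_logOneSubExp_sub_log.comp (tendsto_mul_nhdsGT_zero hc))).sub_const (Real.log c)
  rw [sub_zero, zero_sub] at h
  refine h.congr' ?_
  filter_upwards [self_mem_nhdsWithin] with t ht
  simp only [Function.comp_apply]
  rw [Real.log_mul hc.ne' (mem_Ioi.1 ht).ne']
  ring

theorem hasSum_exp_div {t : ℝ} (ht : 0 < t) :
    HasSum (fun n : ℕ => Real.exp (-(((n : ℝ) + 1) * t)) / ((n : ℝ) + 1)) (-logOneSubExp t) := by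
  have h := Real.hasSum_pow_div_log_of_abs_lt_one (x := Real.exp (-t))
    (by rw [abs_of_pos (Real.exp_pos _)]; linarith [one_sub_exp_neg_pos ht])
  refine h.congr_fun fun n => ?_
  rw [← Real.exp_nat_mul]
  push_cast
  ring_nf

theorem summable_one_div_add_one_sq : Summable fun n : ℕ => 1 / ((n : ℝ) + 1) ^ 2 := by
  have := (summable_nat_add_iff 1).2 hasSum_zeta_two.summable
  simpa using! this

theorem tsum_one_div_add_one_sq : ∑' n : ℕ, 1 / ((n : ℝ) + 1) ^ 2 = Real.pi ^ 2 / 6 := by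
  have h := hasSum_zeta_two.summable.tsum_eq_zero_add
  rw [hasSum_zeta_two.tsum_eq] at h
  simpa using! h.symm

/-- Termwise integration of the expansion of `log (1 - e⁻ˣᵗ)` against a bounded weight. -/
theorem hasSum_integral_mul_exp_div {g : ℝ → ℝ} (hg : Measurable g)
    (hg1 : ∀ t, 0 < t → ‖g t‖ ≤ 1) {x : ℝ} (hx : 0 < x) :
    HasSum (fun n : ℕ => (∫ t in Ioi (0 : ℝ), g t * Real.exp (-(((n : ℝ) + 1) * x * t))) /
      ((n : ℝ) + 1)) (-∫ t in Ioi (0 : ℝ), g t * logOneSubExp (x * t)) := by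
  have hn : ∀ n : ℕ, 0 < ((n : ℝ) + 1) * x := fun n => by positivity
  have hae : ∀ᵐ t ∂(volume.restrict (Ioi (0 : ℝ))), ‖g t‖ ≤ 1 := by
    filter_upwards [ae_restrict_mem measurableSet_Ioi] with t ht using hg1 t ht
  have h_int : ∀ n : ℕ, IntegrableOn
      (fun t => g t * Real.exp (-(((n : ℝ) + 1) * x * t)) / ((n : ℝ) + 1)) (Ioi 0) := fun n =>
    (Integrable.bdd_mul (c := 1) (integrableOn_exp_neg_mul (hn n))
      hg.aestronglyMeasurable hae).div_const _
  have hsum : Summable fun n : ℕ => ∫ t in Ioi (0 : ℝ),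
      ‖g t * Real.exp (-(((n : ℝ) + 1) * x * t)) / ((n : ℝ) + 1)‖ := by
    refine Summable.of_nonneg_of_le (fun n => integral_nonneg fun t => norm_nonneg _)
      (fun n => ?_) (summable_one_div_add_one_sq.mul_left (1 / x))
    have hle : ∫ t in Ioi (0 : ℝ),
        ‖g t * Real.exp (-(((n : ℝ) + 1) * x * t)) / ((n : ℝ) + 1)‖ ≤
        ∫ t in Ioi (0 : ℝ), Real.exp (-(((n : ℝ) + 1) * x * t)) / ((n : ℝ) + 1) := by
      refine setIntegral_mono_on (h_int n).norm
        ((integrableOn_exp_neg_mul (hn n)).div_const _) measurableSet_Ioi fun t ht => ?_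
      rw [norm_div, norm_mul, Real.norm_of_nonneg (Real.exp_pos _).le,
        Real.norm_of_nonneg (by positivity : (0 : ℝ) ≤ (n : ℝ) + 1)]
      gcongr
      exact mul_le_of_le_one_left (Real.exp_pos _).le (hg1 t ht)
    refine hle.trans_eq ?_
    rw [integral_div, integral_exp_neg_mul (hn n)]
    field_simp
  have h := hasSum_integral_of_summable_integral_norm h_int hsum
  simp only [integral_div] at h
  convert! h using 1
  rw [← integral_neg]
  refine setIntegral_congr_fun measurableSet_Ioi fun t ht => ?_
  have ht' := (hasSum_exp_div (mul_pos hx ht)).mul_left (g t)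
  simp only [mul_neg] at ht'
  rw [← ht'.tsum_eq]
  refine tsum_congr fun n => ?_
  rw [mul_div_assoc, mul_assoc]

theorem integral_logOneSubExp_mul {x : ℝ} (hx : 0 < x) :
    ∫ t in Ioi (0 : ℝ), logOneSubExp (x * t) = -(Real.pi ^ 2 / 6 / x) := by
  have h := hasSum_integral_mul_exp_div (g := fun _ => 1) measurable_const (by simp) hx
  simp only [one_mul] at h
  have h2 := h.tsum_eq
  rw [← tsum_one_div_add_one_sq, ← tsum_div_const, ← neg_eq_iff_eq_neg, ← h2]
  refine tsum_congr fun n => ?_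
  rw [integral_exp_neg_mul (by positivity)]
  field_simp

theorem integrableOn_logOneSubExp_mul {x : ℝ} (hx : 0 < x) :
    IntegrableOn (fun t => logOneSubExp (x * t)) (Ioi 0) := by
  refine Integrable.of_integral_ne_zero ?_
  rw [integral_logOneSubExp_mul hx]
  have := Real.pi_pos
  exact neg_ne_zero.2 (by positivity)

theorem integral_digammaKernel_mul_logOneSubExp {x : ℝ} (hx : 0 < x) :
    ∫ t in Ioi (0 : ℝ), digammaKernel t * logOneSubExp (x * t) = herglotzF x := by
  have h := hasSum_integral_mul_exp_div measurable_digammaKernel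
    (fun t => norm_digammaKernel_le_one) hx
  rw [herglotzF, ← neg_neg (∫ t in Ioi (0 : ℝ), _), ← h.tsum_eq, ← tsum_neg]
  refine tsum_congr fun n => ?_
  rw [digamma_sub_log_eq_integral (by positivity), neg_div]

theorem integral_digammaKernel_mul_logOneSubExp_mul {c x : ℝ} (hc : 0 < c) (hx : 0 < x) :
    ∫ t in Ioi (0 : ℝ), digammaKernel (c * t) * logOneSubExp (x * t) = herglotzF (x / c) / c := by
  have h := integral_comp_mul_left_Ioi
    (fun t => digammaKernel t * logOneSubExp (x / c * t)) 0 hc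
  rw [mul_zero, integral_digammaKernel_mul_logOneSubExp (div_pos hx hc), smul_eq_mul] at h
  rw [div_eq_inv_mul, ← h]
  refine setIntegral_congr_fun measurableSet_Ioi fun t _ => ?_
  rw [← mul_assoc, div_mul_cancel₀ _ hc.ne']

/-- The difference of two kernels against the difference of two logarithms, which governs both
functional equations. -/
theorem integrableOn_kernel_sub_mul_sub {c x y : ℝ} (hc : 0 < c) (hx : 0 < x) (hy : 0 < y) :
    IntegrableOn (fun t => (digammaKernel t - c * digammaKernel (c * t)) *
      (logOneSubExp (x * t) - logOneSubExp (y * t))) (Ioi 0) := by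
  have i := (integrableOn_logOneSubExp_mul hx).sub (integrableOn_logOneSubExp_mul hy)
  refine ((i.digammaKernel_mul).sub
    ((i.digammaKernel_comp_mul hc).const_mul c)).congr_fun (fun t _ => ?_) measurableSet_Ioi
  simp only [Pi.sub_apply]
  ring

theorem integral_kernel_sub_mul_sub {c x y : ℝ} (hc : 0 < c) (hx : 0 < x) (hy : 0 < y) :
    ∫ t in Ioi (0 : ℝ), (digammaKernel t - c * digammaKernel (c * t)) *
      (logOneSubExp (x * t) - logOneSubExp (y * t)) =
      herglotzF x - herglotzF y - (herglotzF (x / c) - herglotzF (y / c)) := by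
  have ix := integrableOn_logOneSubExp_mul hx
  have iy := integrableOn_logOneSubExp_mul hy
  have e : ∀ t ∈ Ioi (0 : ℝ), (digammaKernel t - c * digammaKernel (c * t)) *
      (logOneSubExp (x * t) - logOneSubExp (y * t)) =
      (digammaKernel t * logOneSubExp (x * t) - digammaKernel t * logOneSubExp (y * t)) -
      c * (digammaKernel (c * t) * logOneSubExp (x * t) -
        digammaKernel (c * t) * logOneSubExp (y * t)) := fun t _ => by ring
  have i1 : IntegrableOn (fun t => digammaKernel t * logOneSubExp (x * t) -
      digammaKernel t * logOneSubExp (y * t)) (Ioi 0) :=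
    ix.digammaKernel_mul.sub iy.digammaKernel_mul
  have i2 : IntegrableOn (fun t => digammaKernel (c * t) * logOneSubExp (x * t) -
      digammaKernel (c * t) * logOneSubExp (y * t)) (Ioi 0) :=
    (ix.digammaKernel_comp_mul hc).sub (iy.digammaKernel_comp_mul hc)
  rw [setIntegral_congr_fun measurableSet_Ioi e, integral_sub i1 (i2.const_mul c),
    integral_const_mul, integral_sub ix.digammaKernel_mul iy.digammaKernel_mul,
    integral_sub (ix.digammaKernel_comp_mul hc) (iy.digammaKernel_comp_mul hc),
    integral_digammaKernel_mul_logOneSubExp hx, integral_digammaKernel_mul_logOneSubExp hy,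
    integral_digammaKernel_mul_logOneSubExp_mul hc hx,
    integral_digammaKernel_mul_logOneSubExp_mul hc hy]
  field_simp

/-- The fundamental theorem of calculus on `(0, ∞)` with limits at both ends. -/
theorem integral_Ioi_zero_of_hasDerivAt_of_tendsto {f f' : ℝ → ℝ} {l m : ℝ}
    (hderiv : ∀ t ∈ Ioi (0 : ℝ), HasDerivAt f (f' t) t) (h_int : IntegrableOn f' (Ioi 0))
    (h0 : Tendsto f (𝓝[>] 0) (𝓝 l)) (htop : Tendsto f atTop (𝓝 m)) :
    ∫ t in Ioi (0 : ℝ), f' t = m - l := by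
  have hev : ∀ t : ℝ, 0 < t → Function.update f 0 l =ᶠ[𝓝 t] f := fun t ht => by
    filter_upwards [lt_mem_nhds ht] with s hs
    rw [Function.update_of_ne hs.ne']
  have h := integral_Ioi_of_hasDerivAt_of_tendsto (f := Function.update f 0 l) (f' := f')
    (a := 0) (m := m)
    (by rw [continuousWithinAt_update_same, Ici_sdiff_left]; exact h0)
    (fun t ht => (hderiv t ht).congr_of_eventuallyEq (hev t ht)) h_int
    (htop.congr' (by
      filter_upwards [eventually_gt_atTop 0] with s hs
      rw [Function.update_of_ne hs.ne']))
  rwa [Function.update_self] at h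

theorem tendsto_logOneSubExp_mul_atTop {c : ℝ} (hc : 0 < c) :
    Tendsto (fun t => logOneSubExp (c * t)) atTop (𝓝 0) :=
  tendsto_logOneSubExp_atTop.comp (tendsto_id.const_mul_atTop hc)

/-- The two-term functional equation of the Herglotz function. -/
theorem herglotzF_add_herglotzF_one_div {x : ℝ} (hx : 0 < x) :
    herglotzF x + herglotzF (1 / x) =
      2 * herglotzF 1 + Real.log x ^ 2 / 2 - Real.pi ^ 2 / 6 * (x - 2 + 1 / x) := by
  have i1 := integrableOn_kernel_sub_mul_sub hx one_pos hx
  have iA := integrableOn_logOneSubExp_mul one_pos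
  have iB := integrableOn_logOneSubExp_mul hx
  have i2 : IntegrableOn (fun t => logOneSubExp (1 * t) - logOneSubExp (x * t)) (Ioi 0) :=
    iA.sub iB
  have i3 := i2.const_mul (x - 1)
  have h := integral_Ioi_zero_of_hasDerivAt_of_tendsto
    (f := fun t => (logOneSubExp (1 * t) - logOneSubExp (x * t)) ^ 2 / 2)
    (l := (-Real.log x) ^ 2 / 2) (m := (0 - 0) ^ 2 / 2)
    (fun t ht => by
      refine ((((hasDerivAt_logOneSubExp_mul one_pos ht).sub
        (hasDerivAt_logOneSubExp_mul hx ht)).pow 2).div_const 2).congr_deriv ?_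
      simp only [Pi.sub_apply, Pi.add_apply, one_mul]
      push_cast
      ring) (i1.add i3)
    (by simpa using (((tendsto_logOneSubExp_sub_comp_mul hx).pow 2).div_const 2))
    ((((tendsto_logOneSubExp_mul_atTop one_pos).sub
      (tendsto_logOneSubExp_mul_atTop hx)).pow 2).div_const 2)
  simp only [Pi.add_apply] at h
  rw [integral_add i1 i3, integral_const_mul, integral_sub iA iB, integral_logOneSubExp_mul one_pos,
    integral_logOneSubExp_mul hx, integral_kernel_sub_mul_sub hx one_pos hx, div_self hx.ne'] at h
  have e : (x - 1) * (-(Real.pi ^ 2 / 6 / 1) - -(Real.pi ^ 2 / 6 / x)) =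
      -(Real.pi ^ 2 / 6 * (x - 2 + 1 / x)) := by
    field_simp
    ring
  rw [e] at h
  linarith

/-! ### The dilogarithm -/

theorem Li2_zero : Li2 0 = 0 := by
  simp [Li2]

theorem Li2_one : Li2 1 = Real.pi ^ 2 / 6 := by
  rw [← tsum_one_div_add_one_sq]
  simp [Li2]

theorem continuousOn_Li2 : ContinuousOn Li2 (Icc (-1) 1) := by
  refine continuousOn_tsum (u := fun n : ℕ => 1 / ((n : ℝ) + 1) ^ 2)
    (fun n => by fun_prop) summable_one_div_add_one_sq fun n z hz => ?_
  rw [norm_div, norm_pow, Real.norm_of_nonneg (by positivity : (0 : ℝ) ≤ ((n : ℝ) + 1) ^ 2)]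
  gcongr
  exact pow_le_one₀ (norm_nonneg z) (abs_le.2 hz)

theorem hasDerivAt_Li2 {z : ℝ} (h0 : 0 < z) (h1 : z < 1) :
    HasDerivAt Li2 (-Real.log (1 - z) / z) z := by
  obtain ⟨r, hzr, hr1⟩ := exists_between h1
  have hr0 : 0 < r := h0.trans hzr
  have h := hasDerivAt_tsum_of_isPreconnected (u := fun n : ℕ => r ^ n) (t := Ioo 0 r)
    (g := fun (n : ℕ) z => z ^ (n + 1) / ((n : ℝ) + 1) ^ 2)
    (g' := fun (n : ℕ) z => z ^ n / ((n : ℝ) + 1)) (y₀ := z) (y := z)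
    (summable_geometric_of_lt_one hr0.le hr1) isOpen_Ioo isPreconnected_Ioo
    (fun n y _ => by
      refine ((hasDerivAt_pow (n + 1) y).div_const _).congr_deriv ?_
      push_cast
      field_simp)
    (fun n y hy => by
      rw [Real.norm_of_nonneg (div_nonneg (pow_nonneg hy.1.le n) (by positivity))]
      calc y ^ n / ((n : ℝ) + 1) ≤ y ^ n / 1 := by
            gcongr
            · exact pow_nonneg hy.1.le n
            · linarith [(n.cast_nonneg : (0 : ℝ) ≤ n)]
        _ ≤ r ^ n := by
            rw [div_one]
            exact pow_le_pow_left₀ hy.1.le hy.2.le n)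
    ⟨h0, hzr⟩
    (by
      refine Summable.of_nonneg_of_le (fun n => by positivity) (fun n => ?_)
        summable_one_div_add_one_sq
      gcongr
      exact pow_le_one₀ h0.le h1.le)
    ⟨h0, hzr⟩
  refine h.congr_deriv ?_
  rw [← (Real.hasSum_pow_div_log_of_abs_lt_one (by rwa [abs_of_pos h0])).tsum_eq,
    ← tsum_div_const]
  refine tsum_congr fun n => ?_
  field_simp
  ring

theorem tendsto_log_mul_log_one_sub :
    Tendsto (fun y => Real.log y * Real.log (1 - y)) (𝓝[>] 0) (𝓝 0) := by
  have hd : HasDerivAt (fun y : ℝ => Real.log (1 - y)) (-1) 0 := by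
    refine (((hasDerivAt_id (0 : ℝ)).const_sub 1).log (by simp)).congr_deriv ?_
    simp
  have h1 : Tendsto (fun y : ℝ => y⁻¹ * Real.log (1 - y)) (𝓝[>] 0) (𝓝 (-1)) := by
    simpa using hd.tendsto_slope_zero_right
  have h2 : Tendsto (fun y : ℝ => Real.log y * y) (𝓝[>] 0) (𝓝 0) :=
    by simpa [mul_comm] using (Real.continuous_mul_log.tendsto 0).mono_left nhdsWithin_le_nhds
  have h3 := h2.mul h1
  rw [zero_mul] at h3
  refine h3.congr' ?_
  filter_upwards [self_mem_nhdsWithin] with y hy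
  have : y ≠ 0 := (mem_Ioi.1 hy).ne'
  field_simp

/-- Euler's reflection formula for the dilogarithm. -/
theorem Li2_add_Li2_one_sub {y : ℝ} (h0 : 0 < y) (h1 : y < 1) :
    Li2 y + Li2 (1 - y) + Real.log y * Real.log (1 - y) = Real.pi ^ 2 / 6 := by
  set G : ℝ → ℝ := fun y => Li2 y + Li2 (1 - y) + Real.log y * Real.log (1 - y) with hG
  have hderiv : ∀ z ∈ Ioo (0 : ℝ) 1, HasDerivAt G 0 z := by
    intro z hz
    have hz0 : z ≠ 0 := hz.1.ne'
    have hz1 : 1 - z ≠ 0 := (sub_pos.2 hz.2).ne'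
    have hsub : HasDerivAt (fun y : ℝ => 1 - y) (-1) z := (hasDerivAt_id z).const_sub 1
    have ha := hasDerivAt_Li2 hz.1 hz.2
    have hb := (hasDerivAt_Li2 (sub_pos.2 hz.2) (by linarith [hz.1])).comp z hsub
    have hc := (Real.hasDerivAt_log hz0).mul (hsub.log hz1)
    refine ((ha.add hb).add hc).congr_deriv ?_
    rw [sub_sub_cancel]
    field_simp
    ring
  have hconst : ∀ z ∈ Ioo (0 : ℝ) 1, G z = G y := fun z hz =>
    isOpen_Ioo.is_const_of_deriv_eq_zero isPreconnected_Ioo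
      (fun w hw => (hderiv w hw).differentiableAt.differentiableWithinAt)
      (fun w hw => (hderiv w hw).deriv) hz ⟨h0, h1⟩
  have hIoo : Ioo (0 : ℝ) 1 ∈ 𝓝[>] (0 : ℝ) := Ioo_mem_nhdsGT one_pos
  have hL0 : Tendsto Li2 (𝓝[>] 0) (𝓝 0) := by
    have h := (continuousOn_Li2 0 (by norm_num)).mono_left
      (le_inf nhdsWithin_le_nhds (le_principal_iff.2
        (mem_of_superset hIoo fun z hz => ⟨by linarith [hz.1], hz.2.le⟩)))
    rwa [Li2_zero] at h
  have hL1 : Tendsto (fun z => Li2 (1 - z)) (𝓝[>] 0) (𝓝 (Real.pi ^ 2 / 6)) := by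
    have h := continuousOn_Li2 1 (by norm_num)
    rw [ContinuousWithinAt, Li2_one] at h
    refine h.comp (tendsto_nhdsWithin_iff.2 ⟨?_, ?_⟩)
    · have hc : Continuous fun z : ℝ => 1 - z := by fun_prop
      simpa using (hc.tendsto 0).mono_left nhdsWithin_le_nhds
    · filter_upwards [hIoo] with z hz
      exact ⟨by linarith [hz.2], by linarith [hz.1]⟩
  have hlim := (hL0.add hL1).add tendsto_log_mul_log_one_sub
  rw [zero_add, add_zero] at hlim
  refine tendsto_nhds_unique (tendsto_const_nhds.congr' ?_) hlim
  filter_upwards [hIoo] with z hz using (hconst z hz).symm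

theorem rogersL_of_mem_Ioo {y : ℝ} (h0 : 0 < y) (h1 : y < 1) :
    rogersL y = Li2 y + Real.log y * Real.log (1 - y) / 2 := by
  rw [rogersL, if_neg h0.not_gt, if_pos h1.le]

theorem rogersL_one_half : rogersL (1 / 2) = Real.pi ^ 2 / 12 := by
  have h := Li2_add_Li2_one_sub (y := 1 / 2) (by norm_num) (by norm_num)
  rw [rogersL_of_mem_Ioo (by norm_num) (by norm_num)]
  norm_num at h ⊢
  linarith

/-! ### The functional equations -/

/-- The argument `e⁻ˣᵗ (1 - e⁻ᵗ) / (1 - e⁻⁽ˣ⁺¹⁾ᵗ)` of the dilogarithm in the three-term relation. -/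
noncomputable def threeTermArg (x t : ℝ) : ℝ :=
  Real.exp (-(x * t) + logOneSubExp t - logOneSubExp ((x + 1) * t))

theorem one_sub_threeTermArg {x t : ℝ} (hx : 0 < x) (ht : 0 < t) :
    1 - threeTermArg x t = Real.exp (logOneSubExp (x * t) - logOneSubExp ((x + 1) * t)) := by
  have hxt : 0 < (x + 1) * t := by positivity
  have h : Real.exp (-((x + 1) * t)) = Real.exp (-(x * t)) * Real.exp (-t) := by
    rw [← Real.exp_add]; ring_nf
  have hpos := one_sub_exp_neg_pos hxt
  rw [threeTermArg, Real.exp_sub, Real.exp_sub, Real.exp_add, exp_logOneSubExp ht,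
    exp_logOneSubExp hxt, exp_logOneSubExp (mul_pos hx ht), eq_div_iff hpos.ne', sub_mul,
    div_mul_cancel₀ _ hpos.ne', h]
  ring

theorem hasDerivAt_Li2_threeTermArg {x t : ℝ} (hx : 0 < x) (ht : 0 < t) :
    HasDerivAt (fun t => Li2 (threeTermArg x t))
      (-((digammaKernel t - (x + 1) * digammaKernel ((x + 1) * t)) *
        (logOneSubExp (x * t) - logOneSubExp ((x + 1) * t)))) t := by
  have h1 := one_sub_threeTermArg hx ht
  have hz0 : 0 < threeTermArg x t := Real.exp_pos _
  have hz1 : threeTermArg x t < 1 := by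
    have := Real.exp_pos (logOneSubExp (x * t) - logOneSubExp ((x + 1) * t))
    linarith
  have hlin : HasDerivAt (fun t : ℝ => -(x * t)) (-(x * 1)) t :=
    ((hasDerivAt_id t).const_mul x).neg
  have hz := ((hlin.add (hasDerivAt_logOneSubExp ht)).sub
    (hasDerivAt_logOneSubExp_mul (by linarith : 0 < x + 1) ht)).exp
  refine ((hasDerivAt_Li2 hz0 hz1).comp t hz).congr_deriv ?_
  rw [h1, Real.log_exp]
  change _ * (threeTermArg x t * _) = _
  field_simp
  ring

theorem tendsto_threeTermArg_nhdsGT {x : ℝ} (hx : 0 < x) :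
    Tendsto (threeTermArg x) (𝓝[>] 0) (𝓝 (1 / (x + 1))) := by
  have hc : Continuous fun t : ℝ => -(x * t) := by fun_prop
  have h0 : Tendsto (fun t : ℝ => -(x * t)) (𝓝[>] 0) (𝓝 0) := by
    simpa using (hc.tendsto 0).mono_left nhdsWithin_le_nhds
  have h := (h0.add (tendsto_logOneSubExp_sub_comp_mul (by linarith : 0 < x + 1))).rexp
  rw [zero_add, Real.exp_neg, Real.exp_log (by linarith), ← one_div] at h
  exact h.congr fun t => by simp [threeTermArg, add_sub_assoc]

theorem tendsto_threeTermArg_atTop {x : ℝ} (hx : 0 < x) :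
    Tendsto (threeTermArg x) atTop (𝓝 0) := by
  have h1 : Tendsto (fun t : ℝ => -(x * t)) atTop atBot :=
    tendsto_neg_atTop_atBot.comp (tendsto_id.const_mul_atTop hx)
  have h2 := tendsto_logOneSubExp_atTop.sub
    (tendsto_logOneSubExp_mul_atTop (by linarith : 0 < x + 1))
  have h := Real.tendsto_exp_atBot.comp (h1.atBot_add h2)
  exact h.congr fun t => by simp [threeTermArg, add_sub_assoc]

/-- The three-term functional equation of the Herglotz function. -/
theorem herglotzF_sub_sub {x : ℝ} (hx : 0 < x) :
    herglotzF x - herglotzF (x + 1) - herglotzF (x / (x + 1)) =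
      Li2 (1 / (x + 1)) - herglotzF 1 := by
  have hx1 : 0 < x + 1 := by linarith
  have hLi : ∀ z ∈ Ioo (-1 : ℝ) 1, ContinuousAt Li2 z := fun z hz =>
    continuousOn_Li2.continuousAt (Icc_mem_nhds hz.1 hz.2)
  have hmem : 1 / (x + 1) ∈ Ioo (-1 : ℝ) 1 := by
    have h1 : 0 < 1 / (x + 1) := by positivity
    exact ⟨by linarith, (div_lt_one hx1).2 (by linarith)⟩
  have h := integral_Ioi_zero_of_hasDerivAt_of_tendsto
    (fun t ht => hasDerivAt_Li2_threeTermArg hx ht)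
    (integrableOn_kernel_sub_mul_sub hx1 hx hx1).neg
    ((hLi _ hmem).tendsto.comp (tendsto_threeTermArg_nhdsGT hx))
    ((hLi 0 (by norm_num)).tendsto.comp (tendsto_threeTermArg_atTop hx))
  rw [integral_neg, integral_kernel_sub_mul_sub hx1 hx hx1, div_self hx1.ne', Li2_zero] at h
  linarith

theorem mathcalF_three_term_and_inversion (x : ℝ) (hx : 0 < x) :
    (mathcalF x - mathcalF (x + 1) - mathcalF (x / (x + 1)) =
      rogersL (1 / 2) - rogersL (x / (x + 1))) ∧
    mathcalF x + mathcalF (1 / x) = 0 := by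
  have hx1 : 0 < x + 1 := by linarith
  have hy0 : 0 < x / (x + 1) := div_pos hx hx1
  have hy1 : x / (x + 1) < 1 := (div_lt_one hx1).2 (by linarith)
  have hsub : 1 - x / (x + 1) = 1 / (x + 1) := by
    field_simp
    ring
  constructor
  · have hF := herglotzF_sub_sub hx
    have hL := Li2_add_Li2_one_sub hy0 hy1
    have hrat : x - 2 + 1 / x - (x + 1 - 2 + 1 / (x + 1)) -
        (x / (x + 1) - 2 + 1 / (x / (x + 1))) = -1 := by
      field_simp
      ring
    rw [rogersL_one_half, rogersL_of_mem_Ioo hy0 hy1]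
    rw [hsub] at hL ⊢
    simp only [mathcalF]
    rw [one_div (x + 1), Real.log_inv, Real.log_div hx.ne' hx1.ne', ← one_div] at hL ⊢
    linear_combination hF + Real.pi ^ 2 / 12 * hrat + hL
  · have h := herglotzF_add_herglotzF_one_div hx
    simp only [mathcalF]
    rw [one_div_one_div, one_div x, Real.log_inv, ← one_div]
    linear_combination h
end

section
/- For every integer n ≥ 1: F(n) − F(1) = −(n−1)(n−2)·π²/(24n) + (log n)²/2 + ½·∑_{j=1}^{n−1} log²(2·sin(πj/n)). -/
open Real

open Filter Topology

lemma digamma_natCast_add_one (k : ℕ) :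
    digamma ((k : ℝ) + 1) = harmonic k - eulerMascheroniConstant := by
  have h : (k.factorial : ℝ) ≠ 0 := by positivity
  rw [digamma, Real.deriv_Gamma_nat, Real.Gamma_nat_eq_factorial, mul_div_cancel_left₀ _ h]
  ring

lemma abs_digamma_sub_log_natCast_le (k : ℕ) :
    |digamma ((k : ℝ) + 1) - Real.log ((k : ℝ) + 1)| ≤ 1 / ((k : ℝ) + 1) := by
  have h₁ := eulerMascheroniSeq_lt_eulerMascheroniConstant k
  have h₂ := eulerMascheroniConstant_lt_eulerMascheroniSeq' (k + 1)
  rw [eulerMascheroniSeq] at h₁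
  rw [eulerMascheroniSeq', if_neg k.succ_ne_zero, harmonic_succ] at h₂
  push_cast at h₂
  have hk : (0 : ℝ) ≤ 1 / ((k : ℝ) + 1) := by positivity
  rw [digamma_natCast_add_one, abs_le, one_div] at *
  constructor <;> linarith

lemma digamma_natCast {k : ℕ} (hk : k ≠ 0) :
    digamma k = harmonic (k - 1) - eulerMascheroniConstant := by
  obtain ⟨k, rfl⟩ := Nat.exists_eq_succ_of_ne_zero hk
  simpa using digamma_natCast_add_one k

lemma summable_herglotzF_natCast {n : ℕ} (hn : n ≠ 0) :
    Summable fun m : ℕ ↦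
      (digamma (((m : ℝ) + 1) * n) - Real.log (((m : ℝ) + 1) * n)) / ((m : ℝ) + 1) := by
  have hs : Summable fun m : ℕ ↦ 1 / ((m : ℝ) + 1) ^ 2 := by
    simpa using (summable_nat_add_iff 1).2 (Real.summable_one_div_nat_pow.2 one_lt_two)
  refine hs.of_norm_bounded fun m ↦ ?_
  have hm : (0 : ℝ) < (m : ℝ) + 1 := by positivity
  obtain ⟨k, hk⟩ := Nat.exists_eq_succ_of_ne_zero (Nat.mul_ne_zero m.succ_ne_zero hn)
  have hk' : ((m : ℝ) + 1) * n = (k : ℝ) + 1 := by exact_mod_cast hk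
  have hle : (m : ℝ) + 1 ≤ (k : ℝ) + 1 := by
    rw [← hk']
    exact le_mul_of_one_le_right hm.le (by exact_mod_cast Nat.one_le_iff_ne_zero.2 hn)
  rw [norm_div, Real.norm_eq_abs, Real.norm_of_nonneg hm.le, hk', sq, ← div_div]
  gcongr
  exact (abs_digamma_sub_log_natCast_le k).trans (one_div_le_one_div_of_le hm hle)

lemma sum_antidiagonal_one_div_mul_one_div (n : ℕ) :
    ∑ p ∈ Finset.HasAntidiagonal.antidiagonal n, (1 / (p.1 : ℂ)) * (1 / (p.2 : ℂ)) =
      2 * ((harmonic (n - 1) : ℚ) : ℂ) / n := by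
  rcases n with _ | n
  · simp
  rw [Finset.Nat.sum_antidiagonal_eq_sum_range_succ_mk, Finset.sum_range_succ,
    Finset.sum_range_succ']
  have hn : (n : ℂ) + 1 ≠ 0 := by exact_mod_cast n.succ_ne_zero
  have key : ∀ i ∈ Finset.range n, 1 / ((i + 1 : ℕ) : ℂ) * (1 / ((n + 1 - (i + 1) : ℕ) : ℂ)) =
      (1 / ((i : ℂ) + 1) + 1 / (((n - 1 - i : ℕ) : ℂ) + 1)) / (n + 1) := by
    intro i hi
    have hi' := Finset.mem_range.1 hi
    obtain ⟨d, rfl⟩ := Nat.exists_eq_add_of_lt hi'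
    have h₁ : (i : ℂ) + 1 ≠ 0 := by exact_mod_cast i.succ_ne_zero
    have h₂ : (d : ℂ) + 1 ≠ 0 := by exact_mod_cast d.succ_ne_zero
    have e₁ : i + d + 1 + 1 - (i + 1) = d + 1 := by omega
    have e₂ : i + d + 1 - 1 - i = d := by omega
    rw [e₁, e₂]
    push_cast at hn ⊢
    field_simp
    ring
  rw [Finset.sum_congr rfl key, ← Finset.sum_div, Finset.sum_add_distrib,
    Finset.sum_range_reflect (fun i : ℕ ↦ 1 / ((i : ℂ) + 1)) n]
  simp [harmonic]
  ring

lemma hasSum_harmonic_mul_pow_div {z : ℂ} (hz : ‖z‖ < 1) :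
    HasSum (fun k : ℕ ↦ ((harmonic (k - 1) : ℚ) : ℂ) / k * z ^ k)
      (Complex.log (1 - z) ^ 2 / 2) := by
  have h := Complex.hasSum_taylorSeries_neg_log hz
  have hn : Summable fun k : ℕ ↦ ‖z ^ k / (k : ℂ)‖ := h.summable.norm
  have hs := (summable_norm_sum_mul_antidiagonal_of_summable_norm hn hn).of_norm.hasSum
  rw [← tsum_mul_tsum_eq_tsum_sum_antidiagonal_of_summable_norm hn hn, h.tsum_eq] at hs
  convert! hs.div_const 2 using 1
  · ext k
    have : ∀ p ∈ Finset.HasAntidiagonal.antidiagonal k, z ^ p.1 / (p.1 : ℂ) * (z ^ p.2 / (p.2 : ℂ)) =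
        z ^ k * ((1 / (p.1 : ℂ)) * (1 / (p.2 : ℂ))) := by
      intro p hp
      rw [← Finset.HasAntidiagonal.mem_antidiagonal.1 hp, pow_add]
      ring
    rw [Finset.sum_congr rfl this, ← Finset.mul_sum, sum_antidiagonal_one_div_mul_one_div]
    ring
  · ring

lemma IsPrimitiveRoot.sum_pow_pow {ζ : ℂ} {n : ℕ} (hζ : IsPrimitiveRoot ζ n) (k : ℕ) :
    ∑ j ∈ Finset.range n, (ζ ^ j) ^ k = if n ∣ k then (n : ℂ) else 0 := by
  simp_rw [← pow_mul, mul_comm _ k, pow_mul]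
  split_ifs with h
  · simp [(hζ.pow_eq_one_iff_dvd k).2 h]
  · have h1 : ζ ^ k ≠ 1 := fun h' ↦ h ((hζ.pow_eq_one_iff_dvd k).1 h')
    rw [geom_sum_eq h1, ← pow_mul, mul_comm, pow_mul, hζ.pow_eq_one]
    simp

lemma hasSum_multisection {ζ : ℂ} {n : ℕ} (hn : n ≠ 0) (hζ : IsPrimitiveRoot ζ n) {c : ℕ → ℂ}
    {f : ℂ → ℂ} {x : ℂ}
    (hf : ∀ j ∈ Finset.range n, HasSum (fun k ↦ c k * (ζ ^ j * x) ^ k) (f (ζ ^ j * x))) :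
    HasSum (fun m ↦ n * c (n * m) * x ^ (n * m)) (∑ j ∈ Finset.range n, f (ζ ^ j * x)) := by
  have h := hasSum_sum hf
  have hinj : Function.Injective fun m : ℕ ↦ n * m := fun a b hab ↦ by simpa [hn] using hab
  have hsum : ∀ k, ∑ j ∈ Finset.range n, c k * (ζ ^ j * x) ^ k =
      (if n ∣ k then (n : ℂ) else 0) * c k * x ^ k := by
    intro k
    rw [← hζ.sum_pow_pow, Finset.sum_mul, Finset.sum_mul]
    exact Finset.sum_congr rfl fun j _ ↦ by ring
  simp_rw [hsum] at h
  rw [← hinj.hasSum_iff] at h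
  · simpa [Function.comp_def] using h
  · intro k hk
    have : ¬ n ∣ k := fun ⟨m, hm⟩ ↦ hk ⟨m, hm.symm⟩
    simp [this]

lemma Complex.log_one_sub_exp_mul_I {θ : ℝ} (h0 : 0 < θ) (h1 : θ < 2 * π) :
    Complex.log (1 - Complex.exp (θ * Complex.I)) =
      Real.log (2 * Real.sin (θ / 2)) + ((θ / 2 - π / 2 : ℝ) : ℂ) * Complex.I := by
  have hs : 0 < 2 * Real.sin (θ / 2) :=
    mul_pos two_pos (Real.sin_pos_of_pos_of_lt_pi (by linarith) (by linarith))
  have e : 1 - Complex.exp (θ * Complex.I) = Complex.exp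
      (Real.log (2 * Real.sin (θ / 2)) + ((θ / 2 - π / 2 : ℝ) : ℂ) * Complex.I) := by
    rw [Complex.exp_add, ← Complex.ofReal_exp, Real.exp_log hs, Complex.exp_mul_I,
      Complex.exp_mul_I, ← Complex.ofReal_cos, ← Complex.ofReal_cos, ← Complex.ofReal_sin,
      ← Complex.ofReal_sin, Real.cos_sub_pi_div_two, Real.sin_sub_pi_div_two]
    have hc : Real.cos θ = 1 - 2 * Real.sin (θ / 2) ^ 2 := by
      have := Real.cos_two_mul (θ / 2)
      have := Real.sin_sq_add_cos_sq (θ / 2)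
      rw [mul_div_cancel₀ θ two_ne_zero] at *
      linarith
    have hs' : Real.sin θ = 2 * Real.sin (θ / 2) * Real.cos (θ / 2) := by
      rw [← Real.sin_two_mul, mul_div_cancel₀ θ two_ne_zero]
    rw [hc, hs']
    push_cast
    ring
  rw [e, Complex.log_exp] <;> simp <;> linarith [Real.pi_pos]

/-- The coefficients of the series `F(n) - F(1) = ∑ₘ aₘ`, in terms of harmonic numbers. -/
noncomputable def herglotzCoeff (n m : ℕ) : ℝ :=
  ((harmonic (n * m - 1) : ℚ) - (harmonic (m - 1) : ℚ) - Real.log n) / m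

lemma hasSum_herglotzCoeff {n : ℕ} (hn : n ≠ 0) :
    HasSum (herglotzCoeff n) (herglotzF n - herglotzF 1) := by
  have h := (summable_herglotzF_natCast hn).hasSum.sub
    (summable_herglotzF_natCast one_ne_zero).hasSum
  rw [← hasSum_nat_add_iff' 1]
  simp only [Finset.range_one, Finset.sum_singleton]
  have h0 : herglotzCoeff n 0 = 0 := by simp [herglotzCoeff]
  rw [h0, sub_zero, herglotzF, herglotzF]
  convert h using 1
  · ext m
    have hm : ((m : ℝ) + 1) ≠ 0 := by positivity
    have hn' : (n : ℝ) ≠ 0 := by exact_mod_cast hn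
    have e₁ : ((m : ℝ) + 1) * n = (n * (m + 1) : ℕ) := by push_cast; ring
    have e₂ : ((m : ℝ) + 1) * ((1 : ℕ) : ℝ) = (m + 1 : ℕ) := by push_cast; ring
    rw [Real.log_mul hm hn', e₁, e₂, digamma_natCast (Nat.mul_ne_zero hn m.succ_ne_zero),
      digamma_natCast m.succ_ne_zero, herglotzCoeff]
    push_cast
    ring
  · simp

lemma hasSum_herglotzCoeff_mul_pow {n : ℕ} (hn : n ≠ 0) {ζ : ℂ} (hζ : IsPrimitiveRoot ζ n)
    {x : ℝ} (hx0 : 0 ≤ x) (hx1 : x < 1) :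
    HasSum (fun m ↦ herglotzCoeff n m * x ^ (n * m))
      ((∑ j ∈ Finset.range n, (Complex.log (1 - ζ ^ j * x) ^ 2).re) / 2
        - Real.log (1 - x ^ n) ^ 2 / 2 + Real.log n * Real.log (1 - x ^ n)) := by
  have hxn : ‖((x ^ n : ℝ) : ℂ)‖ < 1 := by
    rw [Complex.norm_real, Real.norm_of_nonneg (by positivity)]
    exact pow_lt_one₀ hx0 hx1 hn
  have hA := hasSum_multisection hn hζ (c := fun k ↦ ((harmonic (k - 1) : ℚ) : ℂ) / k)
    (f := fun z ↦ Complex.log (1 - z) ^ 2 / 2) (x := x) fun j _ ↦ by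
      refine hasSum_harmonic_mul_pow_div ?_
      rwa [norm_mul, norm_pow, hζ.norm'_eq_one hn, one_pow, one_mul, Complex.norm_real,
        Real.norm_of_nonneg hx0]
  have hB := hasSum_harmonic_mul_pow_div hxn
  have hC := (Complex.hasSum_taylorSeries_neg_log hxn).mul_left ((Real.log n : ℝ) : ℂ)
  have h := Complex.hasSum_re ((hA.sub hB).sub hC)
  have hlog : Complex.log (1 - ((x ^ n : ℝ) : ℂ)) = (Real.log (1 - x ^ n) : ℝ) := by
    rw [Complex.ofReal_log (sub_nonneg.2 (pow_le_one₀ hx0 hx1.le))]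
    push_cast
    rfl
  have hn' : (n : ℂ) ≠ 0 := by exact_mod_cast hn
  rw [hlog] at h
  convert! h using 1
  · ext m
    rw [← Complex.ofReal_re (herglotzCoeff n m * x ^ (n * m)), herglotzCoeff]
    congr 1
    push_cast
    rw [← pow_mul, mul_div_assoc', mul_div_mul_left _ _ hn']
    ring
  · rw [← Finset.sum_div, Complex.sub_re, Complex.sub_re, Complex.div_ofNat_re, Complex.re_sum,
      ← Complex.ofReal_pow, ← Complex.ofReal_neg, ← Complex.ofReal_mul, Complex.div_ofNat_re,
      Complex.ofReal_re, Complex.ofReal_re]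
    ring

lemma tendsto_tsum_herglotzCoeff_mul_pow {n : ℕ} (hn : n ≠ 0) :
    Tendsto (fun x : ℝ ↦ ∑' m, herglotzCoeff n m * x ^ (n * m)) (𝓝[<] 1)
      (𝓝 (herglotzF n - herglotzF 1)) := by
  rw [← (hasSum_herglotzCoeff hn).tsum_eq]
  refine tendsto_tsum_of_dominated_convergence (hasSum_herglotzCoeff hn).summable.norm
    (fun m ↦ ?_) ?_
  · have : Tendsto (fun x : ℝ ↦ herglotzCoeff n m * x ^ (n * m)) (𝓝 1)
        (𝓝 (herglotzCoeff n m * 1 ^ (n * m))) := Continuous.tendsto (by fun_prop) 1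
    simpa using this.mono_left nhdsWithin_le_nhds
  · filter_upwards [Ioo_mem_nhdsLT (zero_lt_one (α := ℝ))] with x hx m
    rw [norm_mul, norm_pow, Real.norm_of_nonneg hx.1.le]
    exact mul_le_of_le_one_right (norm_nonneg _) (pow_le_one₀ hx.1.le hx.2.le)

lemma tendsto_log_one_sub_sq_sub {n : ℕ} (hn : n ≠ 0) :
    Tendsto (fun x : ℝ ↦ Real.log (1 - x) ^ 2 / 2 - Real.log (1 - x ^ n) ^ 2 / 2
      + Real.log n * Real.log (1 - x ^ n)) (𝓝[<] 1) (𝓝 (Real.log n ^ 2 / 2)) := by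
  have hn' : (n : ℝ) ≠ 0 := by exact_mod_cast hn
  set c : ℝ → ℝ := fun x ↦ Real.log (∑ i ∈ Finset.range n, x ^ i) with hc
  have hc1 : c 1 = Real.log n := by simp [hc]
  have hd : DifferentiableAt ℝ c 1 :=
    DifferentiableAt.log (by fun_prop) (by simpa using hn)
  have hlim : Tendsto c (𝓝[<] 1) (𝓝 (Real.log n)) := by
    rw [← hc1]
    exact hd.continuousAt.tendsto.mono_left nhdsWithin_le_nhds
  have hO : (fun x ↦ Real.log (1 - x) * (c x - c 1)) =O[𝓝[<] 1]
      fun x : ℝ ↦ Real.log (1 - x) * (x - 1) :=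
    (Asymptotics.isBigO_refl _ _).mul (hd.isBigO_sub.mono nhdsWithin_le_nhds)
  have hsub : Tendsto (fun x : ℝ ↦ x - 1) (𝓝[<] 1) (𝓝[<] 0) := by
    refine tendsto_nhdsWithin_iff.2 ⟨?_, ?_⟩
    · have : Tendsto (fun x : ℝ ↦ x - 1) (𝓝 1) (𝓝 (1 - 1)) := Continuous.tendsto (by fun_prop) 1
      simpa using this.mono_left nhdsWithin_le_nhds
    · filter_upwards [self_mem_nhdsWithin] with x hx
      exact sub_neg.2 (Set.mem_Iio.1 hx)
  have h0 : Tendsto (fun x : ℝ ↦ Real.log (1 - x) * (x - 1)) (𝓝[<] 1) (𝓝 0) := by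
    refine (tendsto_log_mul_self_nhdsLT_zero.comp hsub).congr fun x ↦ ?_
    rw [Function.comp_apply, ← Real.log_neg_eq_log, neg_sub]
  have h := ((hO.trans_tendsto h0).neg.sub ((hlim.pow 2).div_const 2)).add
    (hlim.const_mul (Real.log n))
  rw [show -0 - Real.log n ^ 2 / 2 + Real.log n * Real.log n = Real.log n ^ 2 / 2 by ring] at h
  refine h.congr' ?_
  filter_upwards [Ioo_mem_nhdsLT (zero_lt_one (α := ℝ))] with x hx
  have hg : 0 < ∑ i ∈ Finset.range n, x ^ i :=
    Finset.sum_pos (fun i _ ↦ pow_pos hx.1 i) (Finset.nonempty_range_iff.2 hn)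
  rw [← mul_neg_geom_sum, Real.log_mul (sub_pos.2 hx.2).ne' hg.ne', hc1]
  ring

lemma re_log_one_sub_exp_sq {n j : ℕ} (hj : j ∈ Finset.Ico 1 n) :
    (Complex.log (1 - Complex.exp (2 * π * Complex.I / n) ^ j) ^ 2).re =
      Real.log (2 * Real.sin (π * j / n)) ^ 2 - (π * j / n - π / 2) ^ 2 := by
  obtain ⟨hj1, hjn⟩ := Finset.mem_Ico.1 hj
  have hj0 : (0 : ℝ) < j := by exact_mod_cast hj1
  have hjn' : (j : ℝ) < n := by exact_mod_cast hjn
  have hn : (0 : ℝ) < n := hj0.trans hjn'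
  have e : Complex.exp (2 * π * Complex.I / n) ^ j =
      Complex.exp ((2 * (π * j / n) : ℝ) * Complex.I) := by
    rw [← Complex.exp_nat_mul]
    push_cast
    ring_nf
  have hlt : π * j / n < π := by
    rw [div_lt_iff₀ hn]
    exact mul_lt_mul_of_pos_left hjn' pi_pos
  rw [e, Complex.log_one_sub_exp_mul_I (by positivity) (by linarith),
    mul_div_cancel_left₀ _ (two_ne_zero' ℝ), sq]
  simp only [Complex.mul_re, Complex.add_re, Complex.add_im, Complex.ofReal_re, Complex.ofReal_im,
    Complex.mul_im, Complex.I_re, Complex.I_im]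
  ring

lemma sum_Ico_sq_pi_mul_div_sub {n : ℕ} (hn : 1 ≤ n) :
    ∑ j ∈ Finset.Ico 1 n, (π * j / n - π / 2) ^ 2 =
      ((n : ℝ) - 1) * ((n : ℝ) - 2) * π ^ 2 / (12 * n) := by
  have key : ∀ a b : ℝ, ∀ k : ℕ, 1 ≤ k → ∑ j ∈ Finset.Ico 1 k, (a * (j : ℝ) - b) ^ 2 =
      a ^ 2 * ((k - 1) * k * (2 * k - 1) / 6) - a * b * ((k - 1) * k) + b ^ 2 * (k - 1) := by
    intro a b k hk
    induction k, hk using Nat.le_induction with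
    | base => simp
    | succ k hk ih =>
      rw [Finset.sum_Ico_succ_top hk, ih]
      push_cast
      ring
  have hn' : (n : ℝ) ≠ 0 := by positivity
  simp_rw [mul_div_right_comm π]
  rw [key _ _ n hn]
  field_simp
  ring

lemma tendsto_re_log_one_sub_mul_sq {w : ℂ} (hw : ‖w‖ = 1) (hw1 : w ≠ 1) :
    Tendsto (fun x : ℝ ↦ (Complex.log (1 - w * x) ^ 2).re) (𝓝[<] 1)
      (𝓝 (Complex.log (1 - w) ^ 2).re) := by
  have hre : w.re < 1 := by
    refine lt_of_le_of_ne (hw ▸ Complex.re_le_norm w) fun h ↦ hw1 ?_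
    have h2 := Complex.sq_norm w
    rw [Complex.normSq_apply, hw, h] at h2
    exact Complex.ext h (by simpa using h2)
  have hmem : 1 - w * ((1 : ℝ) : ℂ) ∈ Complex.slitPlane := Or.inl (by simpa using hre)
  have hcont : ContinuousAt (fun x : ℝ ↦ (Complex.log (1 - w * x) ^ 2).re) 1 :=
    Complex.continuous_re.continuousAt.comp
      (((by fun_prop : ContinuousAt (fun x : ℝ ↦ 1 - w * (x : ℂ)) 1).clog hmem).pow 2)
  simpa using hcont.tendsto.mono_left nhdsWithin_le_nhds

theorem herglotzF_at_integers (n : ℕ) (hn : 1 ≤ n) :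
    herglotzF n - herglotzF 1 =
      -(((n : ℝ) - 1) * ((n : ℝ) - 2) * Real.pi ^ 2 / (24 * n))
        + Real.log n ^ 2 / 2
        + (∑ j ∈ Finset.Ico 1 n, Real.log (2 * Real.sin (Real.pi * j / n)) ^ 2) / 2 := by
  have hn0 : n ≠ 0 := Nat.one_le_iff_ne_zero.1 hn
  set ζ : ℂ := Complex.exp (2 * π * Complex.I / n) with hζ_def
  have hζ : IsPrimitiveRoot ζ n := Complex.isPrimitiveRoot_exp n hn0
  have hsum : Tendsto (fun x : ℝ ↦ ∑ j ∈ Finset.Ico 1 n, (Complex.log (1 - ζ ^ j * x) ^ 2).re)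
      (𝓝[<] 1) (𝓝 (∑ j ∈ Finset.Ico 1 n, (Complex.log (1 - ζ ^ j) ^ 2).re)) := by
    refine tendsto_finsetSum _ fun j hj ↦ tendsto_re_log_one_sub_mul_sq ?_ ?_
    · rw [norm_pow, hζ.norm'_eq_one hn0, one_pow]
    · obtain ⟨hj1, hjn⟩ := Finset.mem_Ico.1 hj
      exact hζ.pow_ne_one_of_pos_of_lt (by omega) hjn
  have hlim := (tendsto_log_one_sub_sq_sub hn0).add (hsum.div_const 2)
  have heq := tendsto_nhds_unique (tendsto_tsum_herglotzCoeff_mul_pow hn0) (hlim.congr' ?_)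
  · rw [heq, Finset.sum_congr rfl fun j hj ↦ re_log_one_sub_exp_sq hj, Finset.sum_sub_distrib,
      sum_Ico_sq_pi_mul_div_sub hn]
    have hn' : (n : ℝ) ≠ 0 := by positivity
    field_simp
    ring
  · filter_upwards [Ioo_mem_nhdsLT (zero_lt_one (α := ℝ))] with x hx
    have hlog : (Complex.log (1 - ζ ^ 0 * x) ^ 2).re = Real.log (1 - x) ^ 2 := by
      rw [pow_zero, one_mul, ← Complex.ofReal_one, ← Complex.ofReal_sub,
        ← Complex.ofReal_log (sub_nonneg.2 hx.2.le), ← Complex.ofReal_pow, Complex.ofReal_re]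
    rw [(hasSum_herglotzCoeff_mul_pow hn0 hζ hx.1.le hx.2).tsum_eq, Finset.range_eq_Ico,
      Finset.sum_eq_sum_Ico_succ_bot hn, hlog]
    ring
end
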